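/- arXiv:2601.02615 — 5 statements merged into one kernel-verified Lean document; each statement's English description precedes it below -/
import Mathlib

section
/- Let b > 0 be a real number with b ≠ 1 and n ≥ 1 an integer. Then det(V_n(b)) = R_{n+1}(b) = (b^{n+1} − 1)/(b − 1). -/
open Real Matrix Finset

noncomputable def V (b : ℝ) (n : ℕ) : Matrix (Fin n) (Fin n) ℝ :=
  Matrix.of fun i j =>
    if (i : ℕ) = (j : ℕ) then b + 1
    else if (j : ℕ) = (i : ℕ) + 1 then 1
    else if (i : ℕ) = (j : ℕ) + 1 then b
    else 0

theorem V_det_succ_succ (b : ℝ) (n : ℕ) :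
    (V b (n + 2)).det = (b + 1) * (V b (n + 1)).det - b * (V b n).det := by
  have corner : (V b (n + 2)).submatrix Fin.succ (Fin.succAbove 0) = V b (n + 1) := by
    ext i j
    simp [V]
  have minor : ((V b (n + 2)).submatrix Fin.succ (Fin.succAbove 1)).det = b * (V b n).det := by
    have corner' : ((V b (n + 2)).submatrix Fin.succ (Fin.succAbove 1)).submatrix
        (Fin.succAbove 0) Fin.succ = V b n := by
      ext i j
      simp [V]
    rw [det_succ_column_zero, Fin.sum_univ_succ, corner', Finset.sum_eq_zero]
    · simp [V]
    · intro i _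
      simp [V]
  rw [det_succ_row_zero, Fin.sum_univ_succ, Fin.sum_univ_succ, corner, Fin.succ_zero_eq_one,
    minor, Finset.sum_eq_zero]
  · simp [V]
    ring
  · intro i _
    simp [V]

theorem V_det_mul_sub_one (b : ℝ) (n : ℕ) : (V b n).det * (b - 1) = b ^ (n + 1) - 1 := by
  induction n using Nat.twoStepInduction with
  | zero => simp
  | one =>
    simp [V]
    ring
  | more n ih₀ ih₁ =>
    rw [V_det_succ_succ]
    linear_combination (b + 1) * ih₁ - b * ih₀

theorem stmt5 (b : ℝ) (hb : 0 < b) (hb1 : b ≠ 1) (n : ℕ) (hn : 1 ≤ n) :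
    (V b n).det = (b ^ (n + 1) - 1) / (b - 1) :=
  (eq_div_iff (sub_ne_zero.mpr hb1)).mpr (V_det_mul_sub_one b n)
end

section
/- Let b > 0 be a real number and n ≥ 1 an integer. Then the repunit satisfies the spectral product formula R_{n+1}(b) = ∏_{k=1}^{n} (b + 1 + 2√b·cos(kπ/(n+1))), where R_{n+1}(b) = 1 + b + ⋯ + b^{n}. -/
open Real Matrix Finset

open Polynomial in
theorem chebyshevU_eval_eq_prod (n : ℕ) (x : ℝ) :
    (Chebyshev.U ℝ n).eval x
      = ∏ k ∈ Finset.range n, 2 * (x - Real.cos ((k + 1) * Real.pi / (n + 1))) := by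
  have hroots : (Chebyshev.U ℝ n).roots = (Multiset.range n).map
      fun k : ℕ => Real.cos ((k + 1) * Real.pi / (n + 1)) := by
    rw [Chebyshev.roots_U_real, Finset.image_val, Finset.range_val,
      (Chebyshev.roots_U_real_nodup n).dedup]
  have hcard : (Chebyshev.U ℝ n).roots.card = (Chebyshev.U ℝ n).natDegree := by
    rw [hroots, Multiset.card_map, Multiset.card_range, Chebyshev.natDegree_U_natCast]
  have h := C_leadingCoeff_mul_prod_multiset_X_sub_C hcard
  rw [hroots, Multiset.map_map] at h
  rw [← h, eval_mul, eval_C, Chebyshev.leadingCoeff_U_natCast, eval_multiset_prod,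
    Multiset.map_map, Finset.prod_mul_distrib, Finset.prod_const, Finset.card_range]
  simp [Finset.prod]

open Polynomial in
theorem pow_mul_chebyshevU_eval {F : Type*} [Field F] [NeZero (2 : F)] {t : F} (ht : t ≠ 0)
    (n : ℕ) :
    t ^ n * (Chebyshev.U F n).eval ((t ^ 2 + 1) / (2 * t))
      = ∑ k ∈ Finset.range (n + 1), (t ^ 2) ^ k := by
  have h2 : (2 : F) ≠ 0 := NeZero.ne 2
  induction n using Nat.twoStepInduction with
  | zero => simp
  | one =>
    simp [Finset.sum_range_succ]
    field_simp
    ring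
  | more n ih₀ ih₁ =>
    have hx : t * (2 * ((t ^ 2 + 1) / (2 * t))) = t ^ 2 + 1 := by field_simp
    push_cast at ih₀ ih₁ ⊢
    rw [Chebyshev.U_add_two]
    simp only [eval_sub, eval_mul, eval_ofNat, eval_X]
    rw [Finset.sum_range_succ] at ih₁
    rw [Finset.sum_range_succ, Finset.sum_range_succ]
    linear_combination (t ^ (n + 1) * (Chebyshev.U F (n + 1)).eval ((t ^ 2 + 1) / (2 * t))) * hx
      + (t ^ 2 + 1) * ih₁ - t ^ 2 * ih₀

theorem stmt8 (b : ℝ) (hb : 0 < b) (n : ℕ) (hn : 1 ≤ n) :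
    ∑ k ∈ Finset.range (n + 1), b ^ k
      = ∏ k ∈ Finset.range n,
          (b + 1 + 2 * Real.sqrt b * Real.cos ((k + 1) * Real.pi / (n + 1))) := by
  have hs : -√b ≠ 0 := neg_ne_zero.mpr (Real.sqrt_ne_zero'.mpr hb)
  have hsq : (-√b) ^ 2 = b := by rw [neg_sq, Real.sq_sqrt hb.le]
  have h := pow_mul_chebyshevU_eval hs n
  rw [chebyshevU_eval_eq_prod, hsq] at h
  rw [← h]
  nth_rw 1 [← Finset.card_range n]
  rw [← Finset.prod_const, ← Finset.prod_mul_distrib]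
  refine Finset.prod_congr rfl fun k _ => ?_
  field_simp
  ring
end

section
/- Let x be a nonzero real number and n ≥ 1 an integer. Then ∏_{k=1}^{n} (cosh x + cos(kπ/(n+1))) = sinh((n+1)x) / (2^n · sinh x). -/
open Real Matrix Finset

namespace Polynomial.Chebyshev

/-- The Chebyshev polynomial of the second kind, evaluated as a product over its real roots. -/
theorem U_real_eval_eq_prod (n : ℕ) (y : ℝ) :
    (U ℝ n).eval y =
      2 ^ n * ∏ k ∈ Finset.range n, (y - Real.cos ((k + 1) * Real.pi / (n + 1))) := by
  have hinj := (Finset.range n).nodup_map_iff_injOn.mp (roots_U_real_nodup n)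
  have hroots := (roots_U_real n).trans (Finset.image_val_of_injOn hinj)
  have hsplits : (U ℝ n).Splits := by
    rw [splits_iff_card_roots, hroots, natDegree_U_natCast]
    simp
  rw [hsplits.eval_eq_prod_roots, hroots, leadingCoeff_U_natCast, Multiset.map_map,
    Finset.prod_eq_multiset_prod]
  rfl

end Polynomial.Chebyshev

theorem stmt9 (x : ℝ) (hx : x ≠ 0) (n : ℕ) (hn : 1 ≤ n) :
    ∏ k ∈ Finset.range n, (Real.cosh x + Real.cos ((k + 1) * Real.pi / (n + 1)))
      = Real.sinh ((n + 1) * x) / (2 ^ n * Real.sinh x) := by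
  have hreflect : ∏ k ∈ Finset.range n, (Real.cosh x + Real.cos ((k + 1) * Real.pi / (n + 1)))
      = ∏ k ∈ Finset.range n, (Real.cosh x - Real.cos ((k + 1) * Real.pi / (n + 1))) := by
    rw [← Finset.prod_range_reflect]
    refine Finset.prod_congr rfl fun k hk => ?_
    have hk' : k + 1 ≤ n := Finset.mem_range.1 hk
    rw [sub_eq_add_neg, ← Real.cos_pi_sub, Nat.sub_sub, Nat.cast_sub (by omega)]
    congr 2
    push_cast
    field_simp
    ring
  have hU := Polynomial.Chebyshev.U_real_cosh x n
  rw [Polynomial.Chebyshev.U_real_eval_eq_prod] at hU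
  rw [hreflect, eq_div_iff (mul_ne_zero (by positivity) (Real.sinh_ne_zero.2 hx))]
  push_cast at hU
  linarith
end

section
/- Let n ≥ 1 be an integer. Then ∏_{k=1}^{n} (1 + cos(kπ/(n+1))) = (n+1)/2^n. -/
open Real Matrix Finset

open Polynomial in
/-- The Chebyshev polynomial of the second kind, factored over its real roots and evaluated. -/
theorem eval_U_real_eq_prod (n : ℕ) (x : ℝ) :
    (Chebyshev.U ℝ n).eval x =
      2 ^ n * ∏ k ∈ Finset.range n, (x - Real.cos ((k + 1) * Real.pi / (n + 1))) := by
  have hroots : (Chebyshev.U ℝ n).roots =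
      (Multiset.range n).map fun k : ℕ => Real.cos ((k + 1) * Real.pi / (n + 1)) := by
    rw [Chebyshev.roots_U_real, Finset.image_val, Finset.range_val]
    exact (Chebyshev.roots_U_real_nodup n).dedup
  have hsplits : (Chebyshev.U ℝ n).Splits := by
    rw [splits_iff_card_roots, hroots, Chebyshev.natDegree_U_natCast]
    simp
  rw [hsplits.eval_eq_prod_roots, hroots, Chebyshev.leadingCoeff_U_natCast, Multiset.map_map]
  rfl

theorem stmt10 (n : ℕ) (hn : 1 ≤ n) :
    ∏ k ∈ Finset.range n, (1 + Real.cos ((k + 1) * Real.pi / (n + 1)))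
      = (n + 1) / 2 ^ n := by
  have h := eval_U_real_eq_prod n 1
  rw [Polynomial.Chebyshev.U_eval_one, ← Finset.prod_range_reflect] at h
  push_cast at h
  rw [eq_div_iff (by positivity), mul_comm]
  refine Eq.trans ?_ h.symm
  congr 1
  refine Finset.prod_congr rfl fun k hk => ?_
  have hk' : k + 1 ≤ n := Finset.mem_range.mp hk
  rw [sub_eq_add_neg, ← Real.cos_pi_sub, Nat.sub_sub, Nat.cast_sub (by omega)]
  congr 2
  field_simp
  push_cast
  ring
end

section
/- Let b > 0 be a real number and n ≥ 1 an integer. Define the n×n real matrix M by M_{i,j} = (−1)^{i+j}·R_i(b)·R_{n−j+1}(b)/R_{n+1}(b) when i ≤ j, and M_{i,j} = (−1)^{i+j}·b^{i−j}·R_j(b)·R_{n−i+1}(b)/R_{n+1}(b) when i ≥ j, where R_m(b) = 1 + b + ⋯ + b^{m−1} is the repunit (with R_m(1) = m). Then V_n(b)·M = I and M·V_n(b) = I; that is, M = V_n(b)⁻¹. -/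
open Real Matrix Finset

noncomputable def R (b : ℝ) (m : ℕ) : ℝ := ∑ j ∈ Finset.range m, b ^ j

theorem R_zero (b : ℝ) : R b 0 = 0 := by simp [R]

theorem R_succ (b : ℝ) (m : ℕ) : R b (m + 1) = R b m + b ^ m := by
  simp [R, Finset.sum_range_succ]

theorem R_succ' (b : ℝ) (m : ℕ) : R b (m + 1) = b * R b m + 1 := by
  induction m with
  | zero => simp [R]
  | succ m ih => rw [R_succ, ih, pow_succ]; linear_combination b * ih - b * R_succ b m

theorem R_add (b : ℝ) (m k : ℕ) : R b (m + k) = R b m + b ^ m * R b k := by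
  induction k with
  | zero => simp [R_zero]
  | succ k ih => rw [← add_assoc, R_succ, ih, R_succ, pow_add]; ring

theorem R_succ_pos {b : ℝ} (hb : 0 < b) (m : ℕ) : 0 < R b (m + 1) :=
  Finset.sum_pos (fun _ _ => pow_pos hb _) ⟨0, by simp⟩

/-- A row of `V b n` acts on a sequence vanishing at both boundary points `0` and `n + 1`
as a second-order recurrence operator. -/
theorem sum_V_mul (b : ℝ) (n : ℕ) (g : ℕ → ℝ) (h0 : g 0 = 0) (hn : g (n + 1) = 0) (i : Fin n) :
    ∑ k : Fin n, V b n i k * g (k + 1) = b * g i + (b + 1) * g (i + 1) + g (i + 2) := by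
  have hi := i.isLt
  have hV : ∀ k : Fin n, V b n i k * g (k + 1) =
      (if (i : ℕ) = (k : ℕ) + 1 then b * g (k + 1) else 0)
        + (if (i : ℕ) = (k : ℕ) then (b + 1) * g (k + 1) else 0)
        + (if (i : ℕ) + 1 = (k : ℕ) then g (k + 1) else 0) := by
    intro k
    simp only [V, Matrix.of_apply]
    split_ifs <;> first | omega | ring
  have hlow : ∑ k ∈ Finset.range n, (if (i : ℕ) = k + 1 then b * g (k + 1) else 0) = b * g i := by
    generalize (i : ℕ) = p at hi
    cases p with
    | zero => simp [h0]
    | succ p => simp [show p < n by omega]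
  have hhigh : ∑ k ∈ Finset.range n, (if (i : ℕ) + 1 = k then g (k + 1) else 0) = g (i + 2) := by
    rw [Finset.sum_ite_eq]
    split_ifs with h
    · rfl
    · rw [Finset.mem_range] at h
      rw [show (i : ℕ) + 2 = n + 1 by omega, hn]
  rw [Finset.sum_congr rfl fun k _ => hV k, Finset.sum_add_distrib, Finset.sum_add_distrib,
    Fin.sum_univ_eq_sum_range (fun k => if (i : ℕ) = k + 1 then b * g (k + 1) else 0),
    Fin.sum_univ_eq_sum_range (fun k => if (i : ℕ) = k then (b + 1) * g (k + 1) else 0),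
    Fin.sum_univ_eq_sum_range (fun k => if (i : ℕ) + 1 = k then g (k + 1) else 0),
    hlow, hhigh, Finset.sum_ite_eq, if_pos (Finset.mem_range.2 hi)]

/-- The `q`-th column of the inverse of `V b n`, extended to all natural row indices
(rows and columns are numbered from `1`). -/
noncomputable def greenColumn (b : ℝ) (n q p : ℕ) : ℝ :=
  if p ≤ q then (-1) ^ (p + q) * R b p * R b (n + 1 - q) / R b (n + 1)
  else (-1) ^ (p + q) * b ^ (p - q) * R b q * R b (n + 1 - p) / R b (n + 1)

theorem greenColumn_of_le (b : ℝ) (n : ℕ) {q p : ℕ} (h : q ≤ p) :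
    greenColumn b n q p =
      (-1) ^ (p + q) * b ^ (p - q) * R b q * R b (n + 1 - p) / R b (n + 1) := by
  rcases h.eq_or_lt with rfl | h
  · simp [greenColumn]
  · rw [greenColumn, if_neg (by omega)]

theorem greenColumn_recurrence {b : ℝ} (hb : 0 < b) (n : ℕ) (i j : Fin n) :
    b * greenColumn b n (j + 1) i + (b + 1) * greenColumn b n (j + 1) (i + 1)
      + greenColumn b n (j + 1) (i + 2) = if i = j then 1 else 0 := by
  obtain ⟨i, hi⟩ := i
  obtain ⟨j, hj⟩ := j
  have hR := (R_succ_pos hb n).ne'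
  simp only [Fin.mk.injEq]
  rcases lt_trichotomy i j with h | rfl | h
  · rw [if_neg h.ne, greenColumn, greenColumn, greenColumn, if_pos (by omega),
      if_pos (by omega), if_pos (by omega), R_succ' b (i + 1), R_succ' b i]
    field_simp
    ring
  · obtain ⟨e, rfl⟩ : ∃ e, n = i + 1 + e := ⟨n - (i + 1), by omega⟩
    rw [if_pos rfl, greenColumn, if_pos (by omega), greenColumn_of_le _ _ le_rfl,
      greenColumn_of_le _ _ (by omega : i + 1 ≤ i + 2),
      show i + 1 + e + 1 - (i + 1) = e + 1 by omega, show i + 1 + e + 1 - (i + 2) = e by omega,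
      show i + 2 - (i + 1) = 1 by omega, Nat.sub_self]
    have hsign : ((-1 : ℝ) ^ i) ^ 2 = 1 := by rw [← pow_mul, mul_comm, pow_mul]; simp
    have hsum : R b (i + 1 + e + 1) = R b (e + 1) + b ^ (e + 1) * R b (i + 1) := by
      rw [← R_add]; congr 1; omega
    have hi := R_succ' b i
    have he := R_succ b e
    have hadd : (b * ((-1) ^ (i + (i + 1)) * R b i * R b (e + 1))
        + (b + 1) * ((-1) ^ (i + 1 + (i + 1)) * b ^ 0 * R b (i + 1) * R b (e + 1))
        + (-1) ^ (i + 2 + (i + 1)) * b ^ 1 * R b (i + 1) * R b e) = R b (i + 1 + e + 1) := by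
      simp only [pow_add (-1 : ℝ), pow_zero, pow_one]
      rw [hsum]
      linear_combination (-b * R b i * R b (e + 1) + (b + 1) * R b (i + 1) * R b (e + 1)
        - b * R b (i + 1) * R b e) * hsign + R b (e + 1) * hi + b * R b (i + 1) * he
    rw [← mul_div_assoc, ← mul_div_assoc, ← add_div, ← add_div, hadd, div_self hR]
  · obtain ⟨d, rfl⟩ : ∃ d, i = j + 1 + d := ⟨i - (j + 1), by omega⟩
    obtain ⟨e, rfl⟩ : ∃ e, n = j + 1 + d + 1 + e := ⟨n - (j + 1 + d + 1), by omega⟩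
    rw [if_neg h.ne', greenColumn_of_le _ _ (by omega), greenColumn_of_le _ _ (by omega),
      greenColumn_of_le _ _ (by omega),
      show j + 1 + d + 1 + e + 1 - (j + 1 + d) = e + 1 + 1 by omega,
      show j + 1 + d + 1 + e + 1 - (j + 1 + d + 1) = e + 1 by omega,
      show j + 1 + d + 1 + e + 1 - (j + 1 + d + 2) = e by omega,
      show j + 1 + d - (j + 1) = d by omega, show j + 1 + d + 1 - (j + 1) = d + 1 by omega,
      show j + 1 + d + 2 - (j + 1) = d + 2 by omega, R_succ' b (e + 1), R_succ' b e]
    field_simp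
    ring

theorem stmt19 (b : ℝ) (hb : 0 < b) (n : ℕ) (hn : 1 ≤ n)
    (M : Matrix (Fin n) (Fin n) ℝ)
    (hM : M = Matrix.of fun i j : Fin n =>
      if (i : ℕ) ≤ (j : ℕ) then
        (-1 : ℝ) ^ ((i : ℕ) + 1 + ((j : ℕ) + 1)) *
          R b ((i : ℕ) + 1) * R b (n - (j : ℕ)) / R b (n + 1)
      else
        (-1 : ℝ) ^ ((i : ℕ) + 1 + ((j : ℕ) + 1)) * b ^ ((i : ℕ) - (j : ℕ)) *
          R b ((j : ℕ) + 1) * R b (n - (i : ℕ)) / R b (n + 1)) :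
    V b n * M = 1 ∧ M * V b n = 1 := by
  have hMg : ∀ k j : Fin n, M k j = greenColumn b n (j + 1) (k + 1) := by
    intro k j
    simp only [hM, Matrix.of_apply, greenColumn, Nat.add_le_add_iff_right, Nat.add_sub_add_right]
  have hVM : V b n * M = 1 := by
    ext i j
    simp only [Matrix.mul_apply, hMg]
    rw [sum_V_mul b n (greenColumn b n (j + 1)) (by simp [greenColumn, R_zero])
      (by rw [greenColumn_of_le _ _ (by omega)]; simp [R_zero]), greenColumn_recurrence hb,
      Matrix.one_apply]
  exact ⟨hVM, mul_eq_one_comm.1 hVM⟩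
end
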